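/- Let A be the companion matrix of f(x) = (x-1)³(x²−x+1) and B the companion matrix of g(x) = (x+1)³(x²+x+1), and set T = B·A⁻¹ in GL(5,ℚ). Then T² = I with T ≠ I, B has infinite order, and the hypergeometric group Γ(f,g) = ⟨A,B⟩ is the free product of the subgroup generated by T and the subgroup generated by B: the canonical group homomorphism from the abstract free product (ℤ/2ℤ) ∗ ℤ to GL(5,ℚ) sending the generator of ℤ/2ℤ to T and the generator of ℤ to B is injective with image Γ(f,g). -/

import Mathlib

open Polynomial Matrix

/-- The companion matrix of a monic degree-5 rational polynomial `p`:
the `5 × 5` matrix whose entries in position `(i+1, i)` equal `1` for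
`i = 1, ..., 4`, whose last column is `(-p₀, -p₁, -p₂, -p₃, -p₄)ᵀ`
(where `pᵢ` is the coefficient of `xⁱ` in `p`), and whose remaining
entries are `0`. -/
def companionMatrix (p : ℚ[X]) : Matrix (Fin 5) (Fin 5) ℚ :=
  Matrix.of fun i j : Fin 5 =>
    if (j : ℕ) = 4 then -p.coeff i
    else if (i : ℕ) = (j : ℕ) + 1 then 1 else 0

universe u

/-- A ping-pong criterion for the homomorphism out of a binary free product to be injective. -/
theorem Monoid.Coprod.lift_injective_of_ping_pong {H K : Type u} {G α : Type*} [Group H]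
    [Group K] [Group G] [MulAction G α] (f : H →* G) (g : K →* G)
    (X Y : Set α) (hX : X.Nonempty) (hY : Y.Nonempty)
    (hXY : Disjoint X Y) (hf : ∀ h, h ≠ 1 → ∀ y ∈ Y, f h • y ∈ X)
    (hg : ∀ k, k ≠ 1 → ∀ x ∈ X, g k • x ∈ Y) (hK : 3 ≤ Cardinal.mk K) :
    Function.Injective (Monoid.Coprod.lift f g) := by
  let M : Bool → Type u := fun b => bif b then H else K
  let _ : ∀ b, Group (M b) := fun b => match b with
    | true => ‹Group H›
    | false => ‹Group K›
  let F : ∀ b, M b →* G := fun b => match b with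
    | true => f
    | false => g
  let R : ∀ b, M b →* Monoid.Coprod H K := fun b => match b with
    | true => Monoid.Coprod.inl
    | false => Monoid.Coprod.inr
  let toI : Monoid.Coprod H K →* Monoid.CoprodI M := Monoid.Coprod.lift
    (Monoid.CoprodI.of (M := M) (i := true))
    (Monoid.CoprodI.of (M := M) (i := false))
  have hleft : (Monoid.CoprodI.lift R).comp toI = MonoidHom.id _ := by
    apply Monoid.Coprod.hom_ext <;> ext x <;> simp [toI] <;> rfl
  have hcomp : (Monoid.CoprodI.lift F).comp toI = Monoid.Coprod.lift f g := by
    apply Monoid.Coprod.hom_ext <;> ext x <;> simp [toI] <;> rfl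
  have htoI : Function.Injective toI :=
    Function.LeftInverse.injective (g := Monoid.CoprodI.lift R) (DFunLike.congr_fun hleft)
  rw [← hcomp]
  refine Function.Injective.comp (g := Monoid.CoprodI.lift F) ?_ htoI
  refine Monoid.CoprodI.lift_injective_of_ping_pong F (Or.inr ⟨false, ?_⟩)
    (fun b => bif b then X else Y) ?_ ?_ ?_
  · exact hK
  · rintro (_ | _)
    exacts [hY, hX]
  · rintro (_ | _) (_ | _) h
    exacts [absurd rfl h, hXY.symm, hXY, absurd rfl h]
  · rintro (_ | _) (_ | _) h m hm
    · exact absurd rfl h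
    · rintro _ ⟨x, hx, rfl⟩
      exact hg _ hm x hx
    · rintro _ ⟨y, hy, rfl⟩
      exact hf _ hm y hy
    · exact absurd rfl h

/-- The companion matrix of `(X + 1) ^ 3 * (X ^ 2 + X + 1)`. -/
def matB : Matrix (Fin 5) (Fin 5) ℚ :=
  !![0, 0, 0, 0, -1; 1, 0, 0, 0, -4; 0, 1, 0, 0, -7; 0, 0, 1, 0, -7; 0, 0, 0, 1, -4]

/-- The reflection `B * A⁻¹`. -/
def matT : Matrix (Fin 5) (Fin 5) ℚ :=
  !![-1, 0, 0, 0, 0; 0, 1, 0, 0, 0; -14, 0, 1, 0, 0; 0, 0, 0, 1, 0; -8, 0, 0, 0, 1]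

/-- An involution commuting with `matT` and conjugating `matB` to its inverse. -/
def matS : Matrix (Fin 5) (Fin 5) ℚ :=
  !![1, 0, 0, 0, 0; 4, 0, 0, 0, -1; 7, 0, 0, -1, 0; 7, 0, -1, 0, 0; 4, -1, 0, 0, 0]

theorem matA_eq : companionMatrix ((X - 1) ^ 3 * (X ^ 2 - X + 1)) =
    !![0, 0, 0, 0, 1; 1, 0, 0, 0, -4; 0, 1, 0, 0, 7; 0, 0, 1, 0, -7; 0, 0, 0, 1, 4] := by
  have h : ((X - 1) ^ 3 * (X ^ 2 - X + 1) : ℚ[X]) =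
      X ^ 5 - C 4 * X ^ 4 + C 7 * X ^ 3 - C 7 * X ^ 2 + C 4 * X - 1 := by
    simp only [map_ofNat]
    ring
  rw [h]
  ext i j
  fin_cases i <;> fin_cases j <;>
    simp [companionMatrix, coeff_X, coeff_one, coeff_X_pow]

theorem matB_eq : companionMatrix ((X + 1) ^ 3 * (X ^ 2 + X + 1)) = matB := by
  have h : ((X + 1) ^ 3 * (X ^ 2 + X + 1) : ℚ[X]) =
      X ^ 5 + C 4 * X ^ 4 + C 7 * X ^ 3 + C 7 * X ^ 2 + C 4 * X + 1 := by
    simp only [map_ofNat]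
    ring
  rw [h]
  ext i j
  fin_cases i <;> fin_cases j <;>
    simp [companionMatrix, matB, coeff_X, coeff_one, coeff_X_pow]

theorem matT_mul_companionMatrix :
    matT * companionMatrix ((X - 1) ^ 3 * (X ^ 2 - X + 1)) = matB := by
  rw [matA_eq]
  decide +kernel

theorem matS_mul_matS : matS * matS = 1 := by
  decide +kernel

theorem matB_mul_matS_mul_matB : matB * matS * matB = matS := by
  decide +kernel

theorem matT_mul_matS : matT * matS = matS * matT := by
  decide +kernel

theorem matT_mul_matT : matT * matT = 1 := by
  decide +kernel

/-- An open polyhedral cone. It is stable under `-matB`, `matB * matT` and `matB * matS * matT`, and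
disjoint from its images under `-matB * matS` and `-1`. -/
def InCone (y : Fin 5 → ℚ) : Prop :=
  0 < 3 * y 0 - y 1 ∧
  0 < y 0 - y 4 ∧
  0 < 3 * y 0 - 2 * y 1 + y 2 - y 4 ∧
  0 < 151 * y 0 - 87 * y 1 - 37 * y 2 + 13 * y 3 + 63 * y 4 ∧
  0 < -y 0 + y 1 - y 2 + y 3 - y 4 ∧
  0 < -23 * y 0 + y 1 + y 2 + y 3 + y 4 ∧
  0 < y 3 - 3 * y 4 ∧
  0 < -14 * y 0 + y 1 - y 3 + 2 * y 4 ∧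
  0 < 87 * y 0 + 37 * y 1 - 13 * y 2 - 63 * y 3 - 113 * y 4 ∧
  0 < -y 2 + 3 * y 3 - 5 * y 4 ∧
  0 < -59 * y 0 - y 2 + 2 * y 3 + 9 * y 4 ∧
  0 < -37 * y 0 + 13 * y 1 + 63 * y 2 + 113 * y 3 - 749 * y 4 ∧
  0 < y 1 - 3 * y 2 + 5 * y 3 - 6 * y 4 ∧
  0 < -156 * y 0 - y 1 + 2 * y 2 + 9 * y 3 + 16 * y 4 ∧
  0 < -y 0 + 3 * y 1 - 5 * y 2 + 6 * y 3 - 6 * y 4 ∧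
  0 < -277 * y 0 + 2 * y 1 + 9 * y 2 + 16 * y 3 + 19 * y 4 ∧
  0 < -370 * y 0 + 9 * y 1 + 16 * y 2 + 19 * y 3 + 18 * y 4

theorem InCone.neg_matB {y : Fin 5 → ℚ} (h : InCone y) : InCone (-(matB *ᵥ y)) := by
  simp only [InCone] at h
  obtain ⟨h0, h1, h2, h3, h4, h5, h6, h7, h8, h9, h10, h11, h12, h13, h14, h15, h16⟩ := h
  simp only [InCone, matB, Pi.neg_apply, Matrix.mulVec, dotProduct, Fin.sum_univ_five,
    of_apply, cons_val]
  refine ⟨?_, ?_, ?_, ?_, ?_, ?_, ?_, ?_, ?_, ?_, ?_, ?_, ?_, ?_, ?_, ?_, ?_⟩ <;> linarith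

theorem InCone.matB_matT {y : Fin 5 → ℚ} (h : InCone y) : InCone (matB *ᵥ (matT *ᵥ y)) := by
  simp only [InCone] at h
  obtain ⟨h0, h1, h2, h3, h4, h5, h6, h7, h8, h9, h10, h11, h12, h13, h14, h15, h16⟩ := h
  simp only [InCone, matB, matT, Matrix.mulVec, dotProduct, Fin.sum_univ_five,
    of_apply, cons_val]
  refine ⟨?_, ?_, ?_, ?_, ?_, ?_, ?_, ?_, ?_, ?_, ?_, ?_, ?_, ?_, ?_, ?_, ?_⟩ <;> linarith

theorem InCone.matB_matS_matT {y : Fin 5 → ℚ} (h : InCone y) :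
    InCone (matB *ᵥ (matS *ᵥ (matT *ᵥ y))) := by
  simp only [InCone] at h
  obtain ⟨h0, h1, h2, h3, h4, h5, h6, h7, h8, h9, h10, h11, h12, h13, h14, h15, h16⟩ := h
  simp only [InCone, matB, matT, matS, Matrix.mulVec, dotProduct, Fin.sum_univ_five,
    of_apply, cons_val]
  refine ⟨?_, ?_, ?_, ?_, ?_, ?_, ?_, ?_, ?_, ?_, ?_, ?_, ?_, ?_, ?_, ?_, ?_⟩ <;> linarith

theorem InCone.not_neg {y : Fin 5 → ℚ} (h : InCone y) : ¬ InCone (-y) := by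
  intro h'
  simp only [InCone, Pi.neg_apply] at h h'
  linarith

theorem InCone.not_neg_matB_matS {y : Fin 5 → ℚ} (h : InCone y) :
    ¬ InCone (-(matB *ᵥ (matS *ᵥ y))) := by
  intro h'
  simp only [InCone, matB, matS, Pi.neg_apply, Matrix.mulVec, dotProduct, Fin.sum_univ_five,
    of_apply, cons_val] at h h'
  linarith

/-- The vectors mapped into the cone by `-matB` and by `-matB * matS`. -/
def InGap (y : Fin 5 → ℚ) : Prop :=
  InCone (-(matB *ᵥ y)) ∧ InCone (-(matB *ᵥ (matS *ᵥ y)))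

theorem matS_mulVec_matS (y : Fin 5 → ℚ) : matS *ᵥ (matS *ᵥ y) = y := by
  rw [mulVec_mulVec, matS_mul_matS, one_mulVec]

theorem InGap.matS {y : Fin 5 → ℚ} (h : InGap y) : InGap (matS *ᵥ y) :=
  ⟨h.2, by rw [matS_mulVec_matS]; exact h.1⟩

theorem InCone.inGap_matT {y : Fin 5 → ℚ} (h : InCone y) : InGap (-(matT *ᵥ y)) := by
  simp only [InGap, mulVec_neg, neg_neg]
  exact ⟨h.matB_matT, h.matB_matS_matT⟩

theorem InCone.inGap_matT_of_matS {y : Fin 5 → ℚ} (h : InCone (matS *ᵥ y)) :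
    InGap (-(matT *ᵥ y)) := by
  have := h.inGap_matT.matS
  rwa [mulVec_neg, mulVec_mulVec, mulVec_mulVec, mul_assoc, matT_mul_matS, ← mul_assoc,
    matS_mul_matS, one_mul] at this

theorem InCone.not_inGap {y : Fin 5 → ℚ} (h : InCone y) : ¬ InGap y :=
  fun h' => h.not_neg_matB_matS h'.2

theorem InCone.not_inGap_neg {y : Fin 5 → ℚ} (h : InCone y) : ¬ InGap (-y) := by
  intro h'
  have := h'.1
  rw [mulVec_neg] at this
  exact h.neg_matB.not_neg this

theorem inCone_pow_mulVec {y : Fin 5 → ℚ} (h : InCone (-(matB *ᵥ y))) (n : ℕ) :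
    InCone ((-matB) ^ (n + 1) *ᵥ y) := by
  induction n with
  | zero => simpa [neg_mulVec] using h
  | succ n ih =>
    rw [pow_succ', ← mulVec_mulVec, neg_mulVec]
    exact ih.neg_matB

/-- The union of the cone, its image under `matS`, and their negatives. -/
def doubleCones : Set (Fin 5 → ℚ) :=
  {y | (InCone y ∨ InCone (matS *ᵥ y)) ∨ (InCone (-y) ∨ InCone (matS *ᵥ -y))}

/-- The union of the gap and its negative. -/
def doubleGap : Set (Fin 5 → ℚ) :=
  {y | InGap y ∨ InGap (-y)}

theorem neg_mem_doubleCones {y : Fin 5 → ℚ} (h : y ∈ doubleCones) : -y ∈ doubleCones := by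
  simp only [doubleCones, Set.mem_ofPred_eq, neg_neg] at h ⊢
  exact h.symm

theorem disjoint_doubleGap_doubleCones : Disjoint doubleGap doubleCones := by
  have key : ∀ y, (InCone y ∨ InCone (matS *ᵥ y)) → ¬ InGap y ∧ ¬ InGap (-y) := by
    rintro y (h | h)
    · exact ⟨h.not_inGap, h.not_inGap_neg⟩
    · refine ⟨fun h' => h.not_inGap h'.matS, fun h' => h.not_inGap_neg ?_⟩
      rw [← mulVec_neg]
      exact h'.matS
  rw [Set.disjoint_left]
  rintro y hg (h | h)
  · exact hg.elim (key y h).1 (key y h).2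
  · exact hg.elim (by simpa using (key _ h).2) (key _ h).1

theorem matT_mulVec_mem_doubleGap {y : Fin 5 → ℚ} (h : y ∈ doubleCones) :
    matT *ᵥ y ∈ doubleGap := by
  have key : ∀ z, (InCone z ∨ InCone (matS *ᵥ z)) → InGap (-(matT *ᵥ z)) := by
    rintro z (h | h)
    exacts [h.inGap_matT, h.inGap_matT_of_matS]
  rcases h with h | h
  · exact Or.inr (key y h)
  · left
    simpa [mulVec_neg] using key _ h

theorem pow_mulVec_eq_or (n : ℕ) (y : Fin 5 → ℚ) :
    matB ^ n *ᵥ y = (-matB) ^ n *ᵥ y ∨ matB ^ n *ᵥ y = -((-matB) ^ n *ᵥ y) := by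
  rcases neg_one_pow_eq_or (Matrix (Fin 5) (Fin 5) ℚ) n with h | h <;>
    simp [neg_pow matB, h, neg_mulVec]

theorem mem_doubleCones_of_matS {y : Fin 5 → ℚ}
    (h : InCone (matS *ᵥ y) ∨ InCone (-(matS *ᵥ y))) : y ∈ doubleCones := by
  rw [← mulVec_neg] at h
  exact h.imp Or.inr Or.inr

theorem pow_mul_matS_mul_pow (n : ℕ) : matB ^ n * matS * matB ^ n = matS := by
  induction n with
  | zero => simp
  | succ n ih =>
    calc matB ^ (n + 1) * matS * matB ^ (n + 1)
        = matB ^ n * matB * matS * (matB * matB ^ n) := by rw [← pow_succ, ← pow_succ']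
      _ = matB ^ n * (matB * matS * matB) * matB ^ n := by simp only [mul_assoc]
      _ = matS := by rw [matB_mul_matS_mul_matB, ih]

theorem pow_mulVec_inCone {y : Fin 5 → ℚ} (h : InCone (-(matB *ᵥ y))) {n : ℕ} (hn : n ≠ 0) :
    InCone (matB ^ n *ᵥ y) ∨ InCone (-(matB ^ n *ᵥ y)) := by
  obtain ⟨n, rfl⟩ := Nat.exists_eq_succ_of_ne_zero hn
  have := inCone_pow_mulVec h n
  rcases pow_mulVec_eq_or (n + 1) y with h | h <;> simp only [Nat.succ_eq_add_one, h, neg_neg]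
  exacts [Or.inl this, Or.inr this]

theorem InGap.pow_mulVec_mem {y : Fin 5 → ℚ} (h : InGap y) {n : ℕ} (hn : n ≠ 0) :
    matB ^ n *ᵥ y ∈ doubleCones :=
  (pow_mulVec_inCone h.1 hn).imp Or.inl Or.inl

theorem InGap.mem_of_pow_mulVec {y : Fin 5 → ℚ} {n : ℕ} (h : InGap (matB ^ n *ᵥ y))
    (hn : n ≠ 0) : y ∈ doubleCones := by
  apply mem_doubleCones_of_matS
  rw [← pow_mul_matS_mul_pow n, ← mulVec_mulVec, ← mulVec_mulVec]
  exact pow_mulVec_inCone h.2 hn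

theorem zpow_mulVec_mem_doubleCones {B : GL (Fin 5) ℚ} (hB : (B : Matrix _ _ ℚ) = matB)
    {y : Fin 5 → ℚ} (h : y ∈ doubleGap) {n : ℤ} (hn : n ≠ 0) :
    ((B ^ n : GL (Fin 5) ℚ) : Matrix _ _ ℚ) *ᵥ y ∈ doubleCones := by
  have key : ∀ z, InGap z → ((B ^ n : GL (Fin 5) ℚ) : Matrix _ _ ℚ) *ᵥ z ∈ doubleCones := by
    intro z hz
    obtain ⟨m, rfl | rfl⟩ := n.eq_nat_or_neg
    · rw [zpow_natCast, Units.val_pow_eq_pow_val, hB]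
      exact hz.pow_mulVec_mem (by simpa using hn)
    · refine InGap.mem_of_pow_mulVec (n := m) ?_ (by simpa using hn)
      rwa [← hB, ← Units.val_pow_eq_pow_val, mulVec_mulVec, ← Units.val_mul, _root_.zpow_neg,
        zpow_natCast, mul_inv_cancel, Units.val_one, one_mulVec]
  rcases h with h | h
  · exact key y h
  · simpa [mulVec_neg] using neg_mem_doubleCones (key _ h)

theorem doubleCones_nonempty : doubleCones.Nonempty := by
  refine ⟨![-8, -30, -56, -42, -32], Or.inl (Or.inl ?_)⟩
  simp only [InCone, cons_val]
  norm_num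

/-- `Γ(f,g) = ⟨T⟩ ∗ ⟨B⟩` for `f = ((X - 1) ^ 3 * (X ^ 2 - X + 1))`, `g = ((X + 1) ^ 3 * (X ^ 2 + X + 1))`. -/
theorem hypergeometric_free_product_case10 (A B T : GL (Fin 5) ℚ)
    (hA : (↑A : Matrix (Fin 5) (Fin 5) ℚ) = companionMatrix ((X - 1) ^ 3 * (X ^ 2 - X + 1)))
    (hB : (↑B : Matrix (Fin 5) (Fin 5) ℚ) = companionMatrix ((X + 1) ^ 3 * (X ^ 2 + X + 1)))
    (hT : T = B * A⁻¹) :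
    T ^ 2 = 1 ∧ T ≠ 1 ∧ ¬ IsOfFinOrder B ∧
    ∃ φ : Monoid.Coprod (Multiplicative (ZMod 2)) (Multiplicative ℤ) →* GL (Fin 5) ℚ,
      φ (Monoid.Coprod.inl (Multiplicative.ofAdd (1 : ZMod 2))) = T ∧
      φ (Monoid.Coprod.inr (Multiplicative.ofAdd (1 : ℤ))) = B ∧
      Function.Injective φ ∧
      φ.range = Subgroup.closure {A, B} := by
  have hBm : (B : Matrix (Fin 5) (Fin 5) ℚ) = matB := hB.trans matB_eq
  have hTm : (T : Matrix (Fin 5) (Fin 5) ℚ) = matT := by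
    have hTA : T * A = B := by rw [hT, inv_mul_cancel_right]
    have h : matT * (A : Matrix (Fin 5) (Fin 5) ℚ) = T * A := by
      rw [← Units.val_mul T, hTA, hBm, hA, matT_mul_companionMatrix]
    exact (Units.mul_left_inj A).mp h.symm
  have hTT : T ^ 2 = 1 := by
    ext1
    rw [pow_two, Units.val_mul, hTm, matT_mul_matT, Units.val_one]
  have hT1 : T ≠ 1 := by
    rintro rfl
    have := congrFun₂ hTm 0 0
    norm_num [matT] at this
  have hker : zmultiplesHom (Additive (GL (Fin 5) ℚ)) (Additive.ofMul T) (2 : ℕ) = 0 := by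
    rw [zmultiplesHom_apply, natCast_zsmul, ← ofMul_pow, hTT, ofMul_one]
  let f : Multiplicative (ZMod 2) →* GL (Fin 5) ℚ := AddMonoidHom.toMultiplicativeLeft
    (ZMod.lift 2 ⟨_, hker⟩)
  let g : Multiplicative ℤ →* GL (Fin 5) ℚ := zpowersHom _ B
  have hf : f (Multiplicative.ofAdd 1) = T := by
    have := ZMod.lift_coe 2 ⟨_, hker⟩ 1
    simpa [f] using congrArg Additive.toMul this
  have hg (n : ℤ) : g (Multiplicative.ofAdd n) = B ^ n := by
    simp [g]
  let _ : MulAction (GL (Fin 5) ℚ) (Fin 5 → ℚ) :=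
    { smul M y := (M : Matrix _ _ ℚ) *ᵥ y
      one_smul y := one_mulVec y
      mul_smul M N y := (mulVec_mulVec y _ _).symm }
  have hinj : Function.Injective (Monoid.Coprod.lift f g) := by
    refine Monoid.Coprod.lift_injective_of_ping_pong f g doubleGap doubleCones ?_
      doubleCones_nonempty disjoint_doubleGap_doubleCones ?_ ?_ ?_
    · exact doubleCones_nonempty.imp' (matT *ᵥ ·) fun _ => matT_mulVec_mem_doubleGap
    · intro h hh y hy
      obtain rfl : h = Multiplicative.ofAdd 1 := by
        revert h
        decide
      rw [hf]
      change (T : Matrix (Fin 5) (Fin 5) ℚ) *ᵥ y ∈ _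
      rw [hTm]
      exact matT_mulVec_mem_doubleGap hy
    · intro n hn y hy
      exact zpow_mulVec_mem_doubleCones hBm hy (n := n.toAdd) (by simpa using hn)
    · exact (Cardinal.natCast_lt_aleph0 (n := 3)).le.trans (Cardinal.aleph0_le_mk _)
  refine ⟨hTT, hT1, ?_, Monoid.Coprod.lift f g, ?_, ?_, hinj, ?_⟩
  · rw [isOfFinOrder_iff_zpow_eq_one]
    rintro ⟨n, hn, h⟩
    have h1 : g (Multiplicative.ofAdd n) = 1 := (hg n).trans h
    have h2 : (Monoid.Coprod.lift f g) (Monoid.Coprod.inr (Multiplicative.ofAdd n)) = 1 := by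
      simpa using h1
    rw [map_eq_one_iff _ hinj, map_eq_one_iff _ Monoid.Coprod.inr_injective] at h2
    exact hn (by simpa using h2)
  · simpa using hf
  · simpa using hg 1
  · rw [Monoid.Coprod.range_lift]
    have hTmem : T ∈ Subgroup.closure {A, B} := by
      rw [hT]
      exact mul_mem (Subgroup.subset_closure (by simp))
        (inv_mem (Subgroup.subset_closure (by simp)))
    apply le_antisymm
    · refine sup_le ?_ ?_
      · rintro _ ⟨x, rfl⟩
        obtain rfl | rfl : x = 1 ∨ x = Multiplicative.ofAdd 1 := by
          revert x
          decide
        · rw [map_one]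
          exact one_mem _
        · rwa [hf]
      · rintro _ ⟨n, rfl⟩
        exact zpow_mem (Subgroup.subset_closure (by simp)) _
    · have hBmem : B ∈ f.range ⊔ g.range := Subgroup.mem_sup_right ⟨_, (hg 1).trans (zpow_one B)⟩
      have hTmem : T ∈ f.range ⊔ g.range := Subgroup.mem_sup_left ⟨_, hf⟩
      have hAmem : A ∈ f.range ⊔ g.range := by
        rw [show A = T⁻¹ * B by rw [hT]; group]
        exact mul_mem (inv_mem hTmem) hBmem
      rw [Subgroup.closure_le, Set.insert_subset_iff, Set.singleton_subset_iff]
      exact ⟨hAmem, hBmem⟩
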